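/- Let a, b be integers with 2 ≤ b < a and suppose the polynomial P(X) = X^3 − aX^2 + bX − 1 has three real roots β, β', β'' with β > 1, 0 < β' < 1 and 0 < β'' < 1. Then L_⊗(β) ≤ 4. -/

import Mathlib

open Polynomial

/-- The β-transformation `T_β(x) = βx - ⌊βx⌋`. -/
noncomputable def betaT (β : ℝ) : ℝ → ℝ := fun x => β * x - ⌊β * x⌋

/-- `fin(β)`: reals `x` such that `|x|/β^N ∈ [0,1)` and the greedy expansion of
`|x|/β^N` is finite, for some `N, n ∈ ℕ`. -/
def finBeta (β : ℝ) : Set ℝ :=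
  {x | ∃ N n : ℕ, |x| / β ^ N ∈ Set.Ico (0 : ℝ) 1 ∧ (betaT β)^[n] (|x| / β ^ N) = 0}

/-- `ℤ_β`: the set of β-integers. -/
def betaInt (β : ℝ) : Set ℝ :=
  {x | ∃ N : ℕ, |x| / β ^ N ∈ Set.Ico (0 : ℝ) 1 ∧ (betaT β)^[N] (|x| / β ^ N) = 0}

/-- `L_⊕(β)`: the least `L ∈ ℕ` such that `β^L·(x+y) ∈ ℤ_β` for all
`x, y ∈ ℤ_β` with `x + y ∈ fin(β)`. -/
noncomputable def Lplus (β : ℝ) : ℕ :=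
  sInf {L : ℕ | ∀ x ∈ betaInt β, ∀ y ∈ betaInt β,
    x + y ∈ finBeta β → β ^ L * (x + y) ∈ betaInt β}

/-- `L_⊗(β)`: the least `L ∈ ℕ` such that `β^L·(x·y) ∈ ℤ_β` for all
`x, y ∈ ℤ_β` with `x·y ∈ fin(β)`. -/
noncomputable def Lmul (β : ℝ) : ℕ :=
  sInf {L : ℕ | ∀ x ∈ betaInt β, ∀ y ∈ betaInt β,
    x * y ∈ finBeta β → β ^ L * (x * y) ∈ betaInt β}

theorem betaT_iterate_mem_Ico {β u : ℝ} (hu : u ∈ Set.Ico (0 : ℝ) 1) (n : ℕ) :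
    (betaT β)^[n] u ∈ Set.Ico (0 : ℝ) 1 := by
  cases n with
  | zero => exact hu
  | succ n =>
    rw [Function.iterate_succ_apply']
    exact ⟨Int.fract_nonneg _, Int.fract_lt_one _⟩

theorem betaT_iterate_eq_zero_of_le {β u : ℝ} {m n : ℕ} (hmn : m ≤ n)
    (hm : (betaT β)^[m] u = 0) : (betaT β)^[n] u = 0 := by
  induction n, hmn using Nat.le_induction with
  | base => exact hm
  | succ n _ ih => rw [Function.iterate_succ_apply', ih]; simp [betaT]

/-- The integer part of `β ^ n * u` in its greedy expansion is an integer polynomial in `β` whose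
values on `(0, 1)` are controlled, the digits lying between `0` and `β`. -/
theorem exists_digit_polynomial {β u γ : ℝ} (hβ : 0 ≤ β) (hu : u ∈ Set.Ico (0 : ℝ) 1)
    (hγ : γ ∈ Set.Ioo (0 : ℝ) 1) (n : ℕ) :
    ∃ D : ℤ[X], aeval β D = β ^ n * u - (betaT β)^[n] u ∧
      0 ≤ aeval γ D ∧ aeval γ D ≤ β / (1 - γ) := by
  have h1 : 0 < 1 - γ := by linarith [hγ.2]
  induction n with
  | zero => exact ⟨0, by simp, by simp, by simpa using div_nonneg hβ h1.le⟩
  | succ n ih =>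
    obtain ⟨D, hD, h0, hle⟩ := ih
    obtain ⟨ht0, ht1⟩ := betaT_iterate_mem_Ico (β := β) hu n
    have hd0 : (0 : ℝ) ≤ ⌊β * (betaT β)^[n] u⌋ := by
      exact_mod_cast Int.floor_nonneg.2 (mul_nonneg hβ ht0)
    have hd1 : (⌊β * (betaT β)^[n] u⌋ : ℝ) ≤ β :=
      (Int.floor_le _).trans (mul_le_of_le_one_right hβ ht1.le)
    refine ⟨X * D + C ⌊β * (betaT β)^[n] u⌋, ?_, ?_, ?_⟩
    · rw [Function.iterate_succ_apply']
      simp only [map_add, map_mul, aeval_X, hD, betaT, eq_intCast, map_intCast]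
      ring
    · simp only [map_add, map_mul, aeval_X, eq_intCast, map_intCast]
      have := mul_nonneg hγ.1.le h0
      linarith
    · simp only [map_add, map_mul, aeval_X, eq_intCast, map_intCast]
      have := mul_le_mul_of_nonneg_left hle hγ.1.le
      have h2 : γ * (β / (1 - γ)) + β = β / (1 - γ) := by field_simp; ring
      linarith

theorem exists_polynomial_of_mem_betaInt {β γ x : ℝ} (hβ : 0 < β) (hγ : γ ∈ Set.Ioo (0 : ℝ) 1)
    (hx : x ∈ betaInt β) :
    ∃ D : ℤ[X], aeval β D = |x| ∧ 0 ≤ aeval γ D ∧ aeval γ D ≤ β / (1 - γ) := by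
  obtain ⟨N, hu, h0⟩ := hx
  obtain ⟨D, hD, hD'⟩ := exists_digit_polynomial hβ.le hu hγ N
  refine ⟨D, ?_, hD'⟩
  rw [hD, h0]
  field_simp
  ring

/-- If `w` has a finite greedy expansion with more than `L` fractional digits, then some
`β ^ k * |w|` with `L < k` is an integer polynomial in `β` whose value at `γ` is at least `1`. -/
theorem exists_polynomial_of_mem_finBeta {β γ w : ℝ} {L : ℕ} (hβ : 0 < β)
    (hγ : γ ∈ Set.Ioo (0 : ℝ) 1) (hw : w ∈ finBeta β) (hL : β ^ L * w ∉ betaInt β) :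
    ∃ (k : ℕ) (D : ℤ[X]), L < k ∧ aeval β D = β ^ k * |w| ∧ 1 ≤ aeval γ D := by
  classical
  obtain ⟨N, n, hu, hn⟩ := hw
  have hex : ∃ n, (betaT β)^[n] (|w| / β ^ N) = 0 := ⟨n, hn⟩
  obtain ⟨m, hm, hmin⟩ : ∃ m, (betaT β)^[m] (|w| / β ^ N) = 0 ∧
      ∀ j < m, (betaT β)^[j] (|w| / β ^ N) ≠ 0 :=
    ⟨Nat.find hex, Nat.find_spec hex, fun j hj => Nat.find_min hex hj⟩
  have hlt : L + N < m := by
    by_contra! hle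
    refine hL ⟨L + N, ?_⟩
    have : |β ^ L * w| / β ^ (L + N) = |w| / β ^ N := by
      rw [abs_mul, abs_of_pos (pow_pos hβ L), pow_add]
      field_simp
    rw [this]
    exact ⟨hu, betaT_iterate_eq_zero_of_le hle hm⟩
  obtain ⟨m, rfl⟩ : ∃ m', m = m' + 1 := ⟨m - 1, by omega⟩
  obtain ⟨k, hk⟩ : ∃ k, m + 1 = k + N := ⟨m + 1 - N, by omega⟩
  have hne := hmin m (Nat.lt_succ_self m)
  have hmem := betaT_iterate_mem_Ico (β := β) hu m
  obtain ⟨D, hD, h0, -⟩ := exists_digit_polynomial hβ.le hu hγ m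
  rw [Function.iterate_succ_apply'] at hm
  have hfloor : β * (betaT β)^[m] (|w| / β ^ N) = ⌊β * (betaT β)^[m] (|w| / β ^ N)⌋ :=
    sub_eq_zero.1 hm
  have hd : (1 : ℤ) ≤ ⌊β * (betaT β)^[m] (|w| / β ^ N)⌋ := by
    have : 0 < β * (betaT β)^[m] (|w| / β ^ N) :=
      mul_pos hβ (lt_of_le_of_ne hmem.1 hne.symm)
    rw [hfloor] at this
    exact_mod_cast this
  refine ⟨k, X * D + C ⌊β * (betaT β)^[m] (|w| / β ^ N)⌋, by omega, ?_, ?_⟩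
  · simp only [map_add, map_mul, aeval_X, hD, eq_intCast, map_intCast, ← hfloor]
    have : β ^ (m + 1) * (|w| / β ^ N) = β ^ k * |w| := by
      rw [hk, pow_add]
      field_simp
    rw [← this]
    ring
  · simp only [map_add, map_mul, aeval_X, eq_intCast, map_intCast]
    have h1 := mul_nonneg hγ.1.le h0
    have h2 : (1 : ℝ) ≤ ⌊β * (betaT β)^[m] (|w| / β ^ N)⌋ := by exact_mod_cast hd
    linarith

theorem irreducible_cubic {a b : ℤ} (h1 : a ≠ b) (h2 : a + b + 2 ≠ 0) :
    Irreducible (X ^ 3 - C a * X ^ 2 + C b * X - 1 : ℤ[X]) := by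
  have hdeg : (X ^ 3 - C a * X ^ 2 + C b * X - 1 : ℤ[X]).natDegree = 3 := by compute_degree!
  have hmonic : (X ^ 3 - C a * X ^ 2 + C b * X - 1 : ℤ[X]).Monic := by monicity!
  rw [hmonic.irreducible_iff_roots_eq_zero_of_degree_le_three (by omega) (by omega),
    Multiset.eq_zero_iff_forall_notMem]
  intro r hr
  have hr := (mem_roots'.1 hr).2
  simp only [IsRoot, eval_sub, eval_add, eval_pow, eval_X, eval_mul, eval_C, eval_one] at hr
  have hunit : r * (r ^ 2 - a * r + b) = 1 := by linarith
  rcases Int.isUnit_iff.1 (IsUnit.of_mul_eq_one _ hunit) with rfl | rfl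
  · exact h1 (by linarith)
  · exact h2 (by linarith)

theorem aeval_eq_zero_of_cubic {a b : ℤ} (h1 : a ≠ b) (h2 : a + b + 2 ≠ 0) {β γ : ℝ}
    (hβ : β ^ 3 - a * β ^ 2 + b * β - 1 = 0) (hγ : γ ^ 3 - a * γ ^ 2 + b * γ - 1 = 0)
    {Q : ℤ[X]} (hQ : aeval β Q = 0) : aeval γ Q = 0 := by
  have hmonic : (X ^ 3 - C a * X ^ 2 + C b * X - 1 : ℤ[X]).Monic := by monicity!
  have hroot : ∀ x : ℝ, x ^ 3 - a * x ^ 2 + b * x - 1 = 0 →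
      aeval x (X ^ 3 - C a * X ^ 2 + C b * X - 1 : ℤ[X]) = 0 := fun x hx => by simpa using hx
  have hint : IsIntegral ℤ β := ⟨_, hmonic, hroot β hβ⟩
  have hdvd := minpoly.isIntegrallyClosed_dvd hint (hroot β hβ)
  have hassoc := (minpoly.irreducible hint).associated_of_dvd (irreducible_cubic h1 h2) hdvd
  obtain ⟨R, rfl⟩ := hassoc.symm.dvd.trans (minpoly.isIntegrallyClosed_dvd hint hQ)
  rw [map_mul, hroot γ hγ, zero_mul]

theorem smallest_root_le {a b : ℤ} (hba : b < a) {β γ δ : ℝ} (hβ : 1 < β) (hγ : 0 < γ)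
    (hδ : δ < 1) (hγδ : γ ≤ δ)
    (hroots : ∀ x : ℝ, x ^ 3 - (a : ℝ) * x ^ 2 + (b : ℝ) * x - 1
      = (x - β) * (x - γ) * (x - δ)) : γ ≤ 19 / 50 := by
  by_contra! hc
  have hprod : β * γ * δ = 1 := by linarith [hroots 0]
  have hone := hroots 1
  have hneg := hroots (-1)
  have hsum : β + γ + δ = a := by linarith
  have hba' : (b : ℝ) ≤ a - 1 := by exact_mod_cast Int.le_sub_one_of_lt hba
  have hβlt : β < 7 := by nlinarith [mul_lt_mul'' hc (hc.trans_le hγδ) (by norm_num) (by norm_num)]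
  have hs : γ + δ < 1 := by
    by_contra! hs
    nlinarith [mul_nonneg (sub_nonneg.2 hs) (sub_pos.2 hβ).le, mul_pos hγ (hγ.trans_le hγδ)]
  have hβ4 : 4 < β := by
    by_contra! h4
    nlinarith [mul_pos hγ (hγ.trans_le hγδ), sq_nonneg (γ - δ)]
  have ha8 : a < 8 := by
    have : (a : ℝ) < 8 := by linarith
    exact_mod_cast this
  have ha4 : 4 < a := by
    have : (4 : ℝ) < a := by linarith
    exact_mod_cast this
  have hbs : (b : ℝ) = β * (γ + δ) + γ * δ := by linarith
  have hb3 : 3 < b := by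
    have : (3 : ℝ) < b := by nlinarith
    exact_mod_cast this
  have hγ2 : γ < 1 / 2 := by linarith
  have hγroot : γ ^ 3 - a * γ ^ 2 + b * γ - 1 = 0 := by rw [hroots]; ring
  have hc19 : (19 / 50 : ℝ) ^ 3 - a * (19 / 50) ^ 2 + b * (19 / 50) - 1 < 0 := by
    rw [hroots]
    have := mul_pos (mul_pos (show 0 < β - 19 / 50 by linarith) (sub_pos.2 hc))
      (show 0 < δ - 19 / 50 by linarith)
    linarith
  interval_cases a <;> interval_cases b <;> norm_num at hc19 <;> norm_num at hγroot <;>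
    nlinarith [mul_pos (sub_pos.2 hc) (sub_pos.2 hγ2), sq_nonneg (γ - 2 / 5),
      mul_nonneg (sub_pos.2 hγ2).le (sq_nonneg (γ - 2 / 5))]

theorem Lmul_le_four_of_le {a b : ℤ} (hb : 2 ≤ b) (hba : b < a) {β γ δ : ℝ} (hβ : 1 < β)
    (hγ : γ ∈ Set.Ioo (0 : ℝ) 1) (hδ : δ ∈ Set.Ioo (0 : ℝ) 1) (hγδ : γ ≤ δ)
    (hroots : ∀ x : ℝ, x ^ 3 - (a : ℝ) * x ^ 2 + (b : ℝ) * x - 1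
      = (x - β) * (x - γ) * (x - δ)) : Lmul β ≤ 4 := by
  refine Nat.sInf_le fun x hx y hy hxy => ?_
  by_contra hnot
  have hβ0 : 0 < β := by linarith
  obtain ⟨A, hA, hA0, hA1⟩ := exists_polynomial_of_mem_betaInt hβ0 hγ hx
  obtain ⟨B, hB, hB0, hB1⟩ := exists_polynomial_of_mem_betaInt hβ0 hγ hy
  obtain ⟨k, D, hk, hD, hD1⟩ := exists_polynomial_of_mem_finBeta hβ0 hγ hxy hnot
  have hconj : aeval γ (X ^ k * (A * B) - D) = 0 := by
    refine aeval_eq_zero_of_cubic hba.ne' (by omega) (β := β) ?_ ?_ ?_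
    · rw [hroots]; ring
    · rw [hroots]; ring
    · simp only [map_sub, map_mul, map_pow, aeval_X, hA, hB, hD, abs_mul, sub_self]
  simp only [map_sub, map_mul, map_pow, aeval_X] at hconj
  have hγle := smallest_root_le hba hβ hγ.1 hδ.2 hγδ hroots
  have hprod : β * γ * δ = 1 := by linarith [hroots 0]
  have hβγ : β * γ ^ 2 ≤ 1 := by
    nlinarith [mul_le_mul_of_nonneg_left hγδ (mul_pos hβ0 hγ.1).le]
  have h1 : 0 < 1 - γ := sub_pos.2 hγ.2
  have hAB : aeval γ A * aeval γ B ≤ (β / (1 - γ)) ^ 2 := by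
    rw [sq]; exact mul_le_mul hA1 hB1 hB0 (hA0.trans hA1)
  have hpow : γ ^ k ≤ γ ^ 5 := pow_le_pow_of_le_one hγ.1.le hγ.2.le hk
  have hle : γ ^ k * (aeval γ A * aeval γ B) ≤ γ ^ 5 * (β / (1 - γ)) ^ 2 :=
    mul_le_mul hpow hAB (mul_nonneg hA0 hB0) (pow_pos hγ.1 5).le
  have hlt : γ ^ 5 * (β / (1 - γ)) ^ 2 < 1 := by
    rw [div_pow, ← mul_div_assoc, div_lt_one (pow_pos h1 2)]
    calc γ ^ 5 * β ^ 2 = γ * (β * γ ^ 2) ^ 2 := by ring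
      _ ≤ γ * 1 := mul_le_mul_of_nonneg_left (pow_le_one₀ (by positivity) hβγ) hγ.1.le
      _ < (1 - γ) ^ 2 := by nlinarith
  linarith

theorem stmt2 (a b : ℤ) (hb : 2 ≤ b) (hba : b < a) (β β' β'' : ℝ)
    (hβ : 1 < β) (hβ' : β' ∈ Set.Ioo (0 : ℝ) 1) (hβ'' : β'' ∈ Set.Ioo (0 : ℝ) 1)
    (hroots : ∀ x : ℝ, x ^ 3 - (a : ℝ) * x ^ 2 + (b : ℝ) * x - 1
      = (x - β) * (x - β') * (x - β'')) :
    Lmul β ≤ 4 := by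
  rcases le_total β' β'' with h | h
  · exact Lmul_le_four_of_le hb hba hβ hβ' hβ'' h hroots
  · exact Lmul_le_four_of_le hb hba hβ hβ'' hβ' h fun x => by rw [hroots]; ring
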